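/- Strong converse bound (Theorem 3): Let ρ and σ be density matrices on ℂ^k with σ positive definite. For every sequence of tests A^n on (ℂ^k)^{⊗n} (operators with 0 ≤ A^n ≤ I), if limsup_{n→∞} Tr(ρ^{⊗n}(I − A^n)) < 1, then limsup_{n→∞} (1/n) log Tr(σ^{⊗n} A^n) ≥ −D(ρ‖σ). -/

import Mathlib

open scoped BigOperators Classical ComplexOrder
open Matrix Filter

noncomputable def matFun {d : Type*} [Fintype d] [DecidableEq d] (f : ℝ → ℝ)
    (A : Matrix d d ℂ) : Matrix d d ℂ :=
  if hA : A.IsHermitian then hA.cfc f else 0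

noncomputable def matLog {d : Type*} [Fintype d] [DecidableEq d]
    (A : Matrix d d ℂ) : Matrix d d ℂ :=
  matFun Real.log A

noncomputable def tensPow {k : ℕ} (ρ : Matrix (Fin k) (Fin k) ℂ) (n : ℕ) :
    Matrix (Fin n → Fin k) (Fin n → Fin k) ℂ :=
  fun x y => ∏ i, ρ (x i) (y i)

structure IsPVM {d ι : Type*} [Fintype d] [DecidableEq d] [Fintype ι]
    (E : ι → Matrix d d ℂ) : Prop where
  herm : ∀ i, (E i).IsHermitian
  idem : ∀ i, E i * E i = E i
  ne_zero : ∀ i, E i ≠ 0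
  orth : ∀ i j, i ≠ j → E i * E j = 0
  sum_one : ∑ i, E i = 1

noncomputable def pvmWidth {d ι : Type*} [Fintype d] [DecidableEq d] [Fintype ι]
    (E : ι → Matrix d d ℂ) : ℕ :=
  Finset.univ.sup fun i => (E i).rank

def Refines {d ι κ : Type*} [Fintype d] [DecidableEq d] [Fintype ι] [Fintype κ]
    (M : κ → Matrix d d ℂ) (E : ι → Matrix d d ℂ) : Prop :=
  ∃ f : κ → ι, ∀ i, E i = ∑ j ∈ Finset.univ.filter (fun j => f j = i), M j

def IsTest {d : Type*} [Fintype d] [DecidableEq d] (A : Matrix d d ℂ) : Prop :=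
  A.PosSemidef ∧ (1 - A).PosSemidef

noncomputable def pinch {d ι : Type*} [Fintype d] [DecidableEq d] [Fintype ι]
    (E : ι → Matrix d d ℂ) (A : Matrix d d ℂ) : Matrix d d ℂ :=
  ∑ i, E i * A * E i

/-- Quantum relative entropy `D(ρ‖σ) = Tr ρ (log ρ - log σ)`. -/
noncomputable def qRelEnt {d : Type*} [Fintype d] [DecidableEq d]
    (ρ σ : Matrix d d ℂ) : ℝ :=
  (Matrix.trace (ρ * (matLog ρ - matLog σ))).re

/-- The matrix with eigenvectors the columns of `U` and real eigenvalues `f`. -/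
noncomputable def conjDiag {d : Type*} [Fintype d] [DecidableEq d] (U : Matrix d d ℂ)
    (f : d → ℝ) : Matrix d d ℂ :=
  U * diagonal (fun x => (f x : ℂ)) * Uᴴ

section ConjDiag

variable {d : Type*} [Fintype d] [DecidableEq d]

theorem conjDiag_posSemidef (U : Matrix d d ℂ) {f : d → ℝ} (hf : ∀ x, 0 ≤ f x) :
    (conjDiag U f).PosSemidef :=
  (PosSemidef.diagonal fun x => by simpa using hf x).mul_mul_conjTranspose_same U

theorem conjDiag_isHermitian (U : Matrix d d ℂ) (f : d → ℝ) : (conjDiag U f)ᴴ = conjDiag U f := by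
  have h : star (fun x => (f x : ℂ)) = fun x => (f x : ℂ) := by
    ext x; simp
  simp [conjDiag, conjTranspose_mul, diagonal_conjTranspose, h, Matrix.mul_assoc]

theorem conjDiag_mul {U : Matrix d d ℂ} (hU : Uᴴ * U = 1) (f g : d → ℝ) :
    conjDiag U f * conjDiag U g = conjDiag U (fun x => f x * g x) := by
  have h : ∀ X Y : Matrix d d ℂ, (U * X * Uᴴ) * (U * Y * Uᴴ) = U * (X * Y) * Uᴴ := by
    intro X Y
    calc (U * X * Uᴴ) * (U * Y * Uᴴ) = U * X * (Uᴴ * U) * Y * Uᴴ := by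
          simp only [Matrix.mul_assoc]
      _ = _ := by rw [hU]; simp only [Matrix.mul_assoc, Matrix.one_mul]
  simp [conjDiag, h, diagonal_mul_diagonal]

theorem conjDiag_sub (U : Matrix d d ℂ) (f g : d → ℝ) :
    conjDiag U f - conjDiag U g = conjDiag U (fun x => f x - g x) := by
  simp only [conjDiag, ← Matrix.mul_sub, ← Matrix.sub_mul, diagonal_sub, Complex.ofReal_sub]

theorem conjDiag_const_mul (U : Matrix d d ℂ) (c : ℝ) (f : d → ℝ) :
    conjDiag U (fun x => c * f x) = (c : ℂ) • conjDiag U f := by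
  have : diagonal (fun x => ((c * f x : ℝ) : ℂ)) = (c : ℂ) • diagonal (fun x => (f x : ℂ)) := by
    rw [← diagonal_smul]; congr 1; ext x; simp
  rw [conjDiag, this, Matrix.mul_smul, Matrix.smul_mul, conjDiag]

theorem conjDiag_one {U : Matrix d d ℂ} (hU : Uᴴ * U = 1) : conjDiag U (fun _ => 1) = 1 := by
  simp [conjDiag, mul_eq_one_comm.mp hU]

theorem trace_mul_conjDiag (M U : Matrix d d ℂ) (f : d → ℝ) :
    (trace (M * conjDiag U f)).re = ∑ x, f x * ((Uᴴ * M * U) x x).re := by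
  have : trace (M * conjDiag U f) = trace ((Uᴴ * M * U) * diagonal (fun x => (f x : ℂ))) := by
    rw [conjDiag, ← Matrix.mul_assoc, trace_mul_comm]
    simp only [Matrix.mul_assoc]
  rw [this, trace, Complex.re_sum]
  refine Finset.sum_congr rfl fun x _ => ?_
  simp [mul_diagonal, mul_comm]

/-- Spectral decomposition, together with the induced formula for the logarithm. -/
theorem exists_eq_conjDiag {M : Matrix d d ℂ} (hM : M.IsHermitian) :
    ∃ U : Matrix d d ℂ, Uᴴ * U = 1 ∧ M = conjDiag U hM.eigenvalues ∧
      matLog M = conjDiag U (fun x => Real.log (hM.eigenvalues x)) := by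
  refine ⟨hM.eigenvectorUnitary, ?_, ?_, ?_⟩
  · exact Unitary.coe_star_mul_self hM.eigenvectorUnitary
  · conv_lhs => rw [hM.spectral_theorem]
    rfl
  · rw [matLog, matFun, dif_pos hM]
    rfl

end ConjDiag

section Trace

variable {d : Type*} [Fintype d]

open scoped MatrixOrder Matrix.Norms.L2Operator in
theorem exists_eq_conjTranspose_mul_self {M : Matrix d d ℂ} (hM : M.PosSemidef) :
    ∃ B : Matrix d d ℂ, M = Bᴴ * B := by
  classical
  exact CStarAlgebra.nonneg_iff_eq_star_mul_self.mp hM.nonneg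

theorem trace_mul_re_nonneg {M N : Matrix d d ℂ} (hM : M.PosSemidef) (hN : N.PosSemidef) :
    0 ≤ (trace (M * N)).re := by
  obtain ⟨B, rfl⟩ := exists_eq_conjTranspose_mul_self hM
  have h := (hN.mul_mul_conjTranspose_same B).trace_nonneg
  rw [Matrix.mul_assoc, trace_mul_comm]
  exact (Complex.le_def.mp h).1

theorem trace_mul_re_mono {M N N' : Matrix d d ℂ} (hM : M.PosSemidef) (h : (N' - N).PosSemidef) :
    (trace (M * N)).re ≤ (trace (M * N')).re := by
  have := trace_mul_re_nonneg hM h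
  rw [Matrix.mul_sub, trace_sub, Complex.sub_re] at this
  linarith

/-- Matrix version of `|x + y|² ≤ 2 |x|² + 2 |y|²`, weighted by `A` and tested against `M`. -/
theorem trace_mul_add_conj_le {M A : Matrix d d ℂ} (hM : M.PosSemidef) (hA : A.PosSemidef)
    (X Y : Matrix d d ℂ) :
    (trace (M * ((X + Y)ᴴ * A * (X + Y)))).re ≤
      2 * (trace (M * (Xᴴ * A * X))).re + 2 * (trace (M * (Yᴴ * A * Y))).re := by
  have h : ((2 : ℂ) • (Xᴴ * A * X) + (2 : ℂ) • (Yᴴ * A * Y) -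
      (X + Y)ᴴ * A * (X + Y)).PosSemidef := by
    convert! hA.conjTranspose_mul_mul_same (X - Y) using 1
    simp only [conjTranspose_add, conjTranspose_sub, two_smul]
    noncomm_ring
  have := trace_mul_re_mono hM h
  simpa [Matrix.mul_add, trace_add, trace_smul] using this

theorem posSemidef_of_projection {P : Matrix d d ℂ} (hP : Pᴴ = P) (hPP : P * P = P) :
    P.PosSemidef := by
  have := posSemidef_conjTranspose_mul_self P
  rwa [hP, hPP] at this

variable [DecidableEq d]

theorem posSemidef_one_sub_of_projection {P : Matrix d d ℂ} (hP : Pᴴ = P) (hPP : P * P = P) :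
    (1 - P).PosSemidef := by
  apply posSemidef_of_projection
  · simp [hP]
  · rw [Matrix.mul_sub, Matrix.sub_mul, Matrix.sub_mul, hPP]; simp

/-- If the projections `P` and `Q` barely disturb `ρ`, then neither does their product: testing
with `A` after applying them loses at most a factor and a small error. -/
theorem trace_test_le_compressed {ρ A P Q : Matrix d d ℂ} (hρ : ρ.PosSemidef) (hA : IsTest A)
    (hP : Pᴴ = P) (hPP : P * P = P) (hQ : Qᴴ = Q) (hQQ : Q * Q = Q) :
    (trace (ρ * A)).re ≤ 2 * (trace (ρ * ((Q * P)ᴴ * A * (Q * P)))).re +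
      4 * ((trace (ρ * (1 - P))).re + (trace (ρ * (1 - Q))).re) := by
  have hP' : (1 - P)ᴴ = 1 - P := by simp [hP]
  have hQ' : (1 - Q)ᴴ = 1 - Q := by simp [hQ]
  have hPP' : (1 - P) * (1 - P) = 1 - P := by
    rw [Matrix.mul_sub, Matrix.sub_mul, Matrix.sub_mul, hPP]; simp
  have hQQ' : (1 - Q) * (1 - Q) = 1 - Q := by
    rw [Matrix.mul_sub, Matrix.sub_mul, Matrix.sub_mul, hQQ]; simp
  have h1 := trace_mul_add_conj_le hρ hA.1 (Q * P) (1 - Q * P)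
  rw [add_sub_cancel] at h1
  simp only [conjTranspose_one, Matrix.one_mul, Matrix.mul_one] at h1
  have h2 : (trace (ρ * ((1 - Q * P)ᴴ * A * (1 - Q * P)))).re ≤
      (trace (ρ * ((1 - Q * P)ᴴ * 1 * (1 - Q * P)))).re := by
    apply trace_mul_re_mono hρ
    rw [← Matrix.sub_mul, ← Matrix.mul_sub]
    exact hA.2.conjTranspose_mul_mul_same _
  have h3 := trace_mul_add_conj_le hρ PosSemidef.one (Q * (1 - P)) (1 - Q)
  have e : Q * (1 - P) + (1 - Q) = 1 - Q * P := by noncomm_ring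
  rw [e] at h3
  have e2 : (1 - Q)ᴴ * 1 * (1 - Q) = 1 - Q := by rw [hQ', Matrix.mul_one, hQQ']
  rw [e2] at h3
  have h4 : (trace (ρ * ((Q * (1 - P))ᴴ * 1 * (Q * (1 - P))))).re ≤ (trace (ρ * (1 - P))).re := by
    apply trace_mul_re_mono hρ
    have := (posSemidef_one_sub_of_projection hQ hQQ).conjTranspose_mul_mul_same (1 - P)
    convert! this using 1
    have e3 : (Q * (1 - P))ᴴ * 1 * (Q * (1 - P)) = (1 - P) * (Q * Q) * (1 - P) := by
      rw [conjTranspose_mul, hP', hQ, Matrix.mul_one]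
      simp only [Matrix.mul_assoc]
    rw [e3, hQQ, hP', Matrix.mul_sub (1 - P) 1 Q, Matrix.sub_mul _ _ (1 - P), Matrix.mul_one, hPP']
  linarith

/-- One-shot converse bound for a test `A`, given projections on which `ρ` is at most `a` and `σ`
is at least `b`. -/
theorem trace_test_le {ρ σ A P Q : Matrix d d ℂ} {a b : ℝ} (hρ : ρ.PosSemidef) (hA : IsTest A)
    (hP : Pᴴ = P) (hPP : P * P = P) (hQ : Qᴴ = Q) (hQQ : Q * Q = Q)
    (ha : 0 ≤ a) (hb : 0 < b) (haP : ((a : ℂ) • 1 - P * ρ * P).PosSemidef)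
    (hbQ : (σ - (b : ℂ) • Q).PosSemidef) :
    (trace (ρ * A)).re ≤ 2 * (a / b * (trace (σ * A)).re) +
      4 * ((trace (ρ * (1 - P))).re + (trace (ρ * (1 - Q))).re) := by
  refine (trace_test_le_compressed hρ hA hP hPP hQ hQQ).trans ?_
  have hQAQ : (Q * A * Q).PosSemidef := by
    simpa only [hQ] using hA.1.conjTranspose_mul_mul_same Q
  have h1 : (trace (ρ * ((Q * P)ᴴ * A * (Q * P)))).re ≤ a * (trace (A * Q)).re := by
    have e : trace (ρ * ((Q * P)ᴴ * A * (Q * P))) = trace ((Q * A * Q) * (P * ρ * P)) := by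
      rw [conjTranspose_mul, hP, hQ]
      calc trace (ρ * (P * Q * A * (Q * P))) = trace ((ρ * P) * (Q * A * Q * P)) := by
            simp only [Matrix.mul_assoc]
        _ = trace ((Q * A * Q * P) * (ρ * P)) := trace_mul_comm _ _
        _ = _ := by simp only [Matrix.mul_assoc]
    have e' : trace ((Q * A * Q) * ((a : ℂ) • 1)) = a * trace (A * Q) := by
      rw [Matrix.mul_smul, Matrix.mul_one, trace_smul, smul_eq_mul, Matrix.mul_assoc,
        trace_mul_comm Q, Matrix.mul_assoc, hQQ]
    have := trace_mul_re_mono hQAQ haP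
    rwa [← e, e', Complex.re_ofReal_mul] at this
  have h2 : b * (trace (A * Q)).re ≤ (trace (σ * A)).re := by
    have := trace_mul_re_mono hA.1 hbQ
    rwa [Matrix.mul_smul, trace_smul, smul_eq_mul, Complex.re_ofReal_mul,
      trace_mul_comm A σ] at this
  have h3 : a * (trace (A * Q)).re ≤ a / b * (trace (σ * A)).re := by
    calc a * (trace (A * Q)).re = a / b * (b * (trace (A * Q)).re) := by field_simp
      _ ≤ _ := by gcongr
  linarith

end Trace

section TensPow

variable {k : ℕ}

theorem tensPow_mul (M N : Matrix (Fin k) (Fin k) ℂ) (n : ℕ) :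
    tensPow (M * N) n = tensPow M n * tensPow N n := by
  ext x y
  simp only [tensPow, mul_apply, ← Finset.prod_mul_distrib, Finset.prod_univ_sum,
    Fintype.piFinset_univ]

theorem tensPow_conjTranspose (M : Matrix (Fin k) (Fin k) ℂ) (n : ℕ) :
    tensPow Mᴴ n = (tensPow M n)ᴴ := by
  ext x y
  simp [tensPow, conjTranspose_apply]

theorem tensPow_diagonal (f : Fin k → ℂ) (n : ℕ) :
    tensPow (diagonal f) n = diagonal (fun x => ∏ i, f (x i)) := by
  ext x y
  by_cases h : x = y
  · subst h
    simp [tensPow]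
  · obtain ⟨i, hi⟩ := Function.ne_iff.mp h
    rw [diagonal_apply_ne _ h]
    exact Finset.prod_eq_zero (Finset.mem_univ i) (diagonal_apply_ne _ hi)

theorem tensPow_one (n : ℕ) : tensPow (1 : Matrix (Fin k) (Fin k) ℂ) n = 1 := by
  rw [← diagonal_one, tensPow_diagonal]
  simp

theorem tensPow_conjDiag (U : Matrix (Fin k) (Fin k) ℂ) (f : Fin k → ℝ) (n : ℕ) :
    tensPow (conjDiag U f) n = conjDiag (tensPow U n) (fun x => ∏ i, f (x i)) := by
  simp [conjDiag, tensPow_mul, tensPow_conjTranspose, tensPow_diagonal]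

theorem tensPow_trace (M : Matrix (Fin k) (Fin k) ℂ) (n : ℕ) :
    trace (tensPow M n) = trace M ^ n := by
  have := Finset.prod_univ_sum (fun _ : Fin n => (Finset.univ : Finset (Fin k)))
    (fun _ j => M j j)
  simp only [Finset.prod_const, Finset.card_univ, Fintype.card_fin, Fintype.piFinset_univ] at this
  exact this.symm

theorem tensPow_posSemidef {M : Matrix (Fin k) (Fin k) ℂ} (hM : M.PosSemidef) (n : ℕ) :
    (tensPow M n).PosSemidef := by
  obtain ⟨B, rfl⟩ := exists_eq_conjTranspose_mul_self hM
  rw [tensPow_mul, tensPow_conjTranspose]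
  exact posSemidef_conjTranspose_mul_self _

end TensPow

section Concentration

variable {k : ℕ}

theorem sum_fin_succ_pi (n : ℕ) (F : (Fin (n + 1) → Fin k) → ℝ) :
    ∑ x, F x = ∑ j, ∑ y : Fin n → Fin k, F (Fin.cons j y) := by
  rw [← (Fin.consEquiv fun _ => Fin k).sum_comp, Fintype.sum_prod_type]
  rfl

/-- Second moment of a sum of independent centred variables. -/
theorem iid_moments {p g : Fin k → ℝ} (hp : ∑ j, p j = 1) (hg : ∑ j, p j * g j = 0) (n : ℕ) :
    ∑ x : Fin n → Fin k, ∏ i, p (x i) = 1 ∧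
    ∑ x : Fin n → Fin k, (∏ i, p (x i)) * ∑ i, g (x i) = 0 ∧
    ∑ x : Fin n → Fin k, (∏ i, p (x i)) * (∑ i, g (x i)) ^ 2 = n * ∑ j, p j * g j ^ 2 := by
  induction n with
  | zero => simp
  | succ n ih =>
    obtain ⟨h0, h1, h2⟩ := ih
    simp only [sum_fin_succ_pi, Fin.prod_univ_succ, Fin.sum_univ_succ, Fin.cons_zero, Fin.cons_succ]
    refine ⟨?_, ?_, ?_⟩
    · simp only [← Finset.mul_sum, h0, mul_one, hp]
    · have : ∀ j, ∑ y : Fin n → Fin k, p j * (∏ i, p (y i)) * (g j + ∑ i, g (y i)) = p j * g j := by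
        intro j
        calc _ = p j * g j * ∑ y : Fin n → Fin k, ∏ i, p (y i) +
              p j * ∑ y : Fin n → Fin k, (∏ i, p (y i)) * ∑ i, g (y i) := by
              rw [Finset.mul_sum, Finset.mul_sum, ← Finset.sum_add_distrib]
              exact Finset.sum_congr rfl fun y _ => by ring
          _ = _ := by rw [h0, h1]; ring
      simp only [this, hg]
    · have : ∀ j, ∑ y : Fin n → Fin k, p j * (∏ i, p (y i)) * (g j + ∑ i, g (y i)) ^ 2 =
          p j * g j ^ 2 + p j * (n * ∑ j, p j * g j ^ 2) := by
        intro j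
        calc _ = p j * g j ^ 2 * ∑ y : Fin n → Fin k, ∏ i, p (y i) +
              2 * p j * g j * ∑ y : Fin n → Fin k, (∏ i, p (y i)) * ∑ i, g (y i) +
              p j * ∑ y : Fin n → Fin k, (∏ i, p (y i)) * (∑ i, g (y i)) ^ 2 := by
              rw [Finset.mul_sum, Finset.mul_sum, Finset.mul_sum, ← Finset.sum_add_distrib,
                ← Finset.sum_add_distrib]
              exact Finset.sum_congr rfl fun y _ => by ring
          _ = _ := by rw [h0, h1, h2]; ring
      simp only [this, Finset.sum_add_distrib, ← Finset.sum_mul, hp]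
      push_cast
      ring

/-- Chebyshev's inequality for the empirical mean of an i.i.d. sample from `p`. -/
theorem iid_tail_le {p f : Fin k → ℝ} (hp0 : ∀ j, 0 ≤ p j) (hp : ∑ j, p j = 1) {ε : ℝ}
    (hε : 0 < ε) {n : ℕ} (hn : 0 < n) :
    ∑ x : Fin n → Fin k, (1 - if ∑ i, f (x i) ≤ n * (∑ j, p j * f j + ε) then (1 : ℝ) else 0) *
      ∏ i, p (x i) ≤ (∑ j, p j * (f j - ∑ l, p l * f l) ^ 2) / ε ^ 2 * (n : ℝ)⁻¹ := by
  set m := ∑ j, p j * f j with hm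
  have hn' : (0 : ℝ) < n := Nat.cast_pos.mpr hn
  have hg : ∑ j, p j * (f j - m) = 0 := by
    simp only [mul_sub, Finset.sum_sub_distrib, ← Finset.sum_mul, hp, ← hm]
    ring
  have h2 := (iid_moments hp hg n).2.2
  have key : ((n : ℝ) * ε) ^ 2 * ∑ x : Fin n → Fin k,
      (1 - if ∑ i, f (x i) ≤ n * (m + ε) then (1 : ℝ) else 0) * ∏ i, p (x i) ≤
      n * ∑ j, p j * (f j - m) ^ 2 := by
    rw [← h2, Finset.mul_sum]
    refine Finset.sum_le_sum fun x _ => ?_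
    have hpx : 0 ≤ ∏ i, p (x i) := Finset.prod_nonneg fun i _ => hp0 _
    have hs : ∑ i, (f (x i) - m) = ∑ i, f (x i) - n * m := by simp [Finset.sum_sub_distrib]
    split_ifs with h
    · simp only [sub_self, zero_mul, mul_zero]
      positivity
    · rw [sub_zero, one_mul, mul_comm]
      refine mul_le_mul_of_nonneg_left ?_ hpx
      apply pow_le_pow_left₀ (by positivity)
      rw [hs]
      push Not at h
      linarith
  have : (∑ j, p j * (f j - m) ^ 2) / ε ^ 2 * (n : ℝ)⁻¹ =
      (n * ∑ j, p j * (f j - m) ^ 2) / ((n : ℝ) * ε) ^ 2 := by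
    field_simp
  rw [this, le_div_iff₀ (by positivity)]
  linarith

end Concentration

/-- Nonasymptotic strong converse bound, with an error term of order `1 / n`. -/
theorem exists_trace_tensPow_test_le {k : ℕ} {ρ σ : Matrix (Fin k) (Fin k) ℂ}
    (hρ : ρ.PosSemidef) (hρ1 : ρ.trace = 1) (hσ : σ.PosDef) {ε : ℝ} (hε : 0 < ε) :
    ∃ C : ℝ, ∀ n : ℕ, 0 < n → ∀ A, IsTest A →
      (trace (tensPow ρ n * A)).re ≤
        2 * (Real.exp (n * (qRelEnt ρ σ + 2 * ε)) * (trace (tensPow σ n * A)).re) +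
          C * (n : ℝ)⁻¹ := by
  obtain ⟨U, hU, hρU, hlogρ⟩ := exists_eq_conjDiag hρ.isHermitian
  obtain ⟨W, hW, hσW, hlogσ⟩ := exists_eq_conjDiag hσ.isHermitian
  have hr0 : ∀ j, 0 ≤ hρ.isHermitian.eigenvalues j := hρ.eigenvalues_nonneg
  have hs0 : ∀ j, 0 < hσ.isHermitian.eigenvalues j := hσ.eigenvalues_pos
  generalize hρ.isHermitian.eigenvalues = r at *
  generalize hσ.isHermitian.eigenvalues = s at *
  set p : Fin k → ℝ := fun j => ((Wᴴ * ρ * W) j j).re with hpdef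
  have hpps : (Wᴴ * ρ * W).PosSemidef := hρ.conjTranspose_mul_mul_same W
  have hp0 : ∀ j, 0 ≤ p j := fun j => (Complex.le_def.mp hpps.diag_nonneg).1
  have hpc : ∀ j, (Wᴴ * ρ * W) j j = (p j : ℂ) := fun j => by
    have := (Complex.le_def.mp (hpps.diag_nonneg (i := j))).2
    apply Complex.ext
    · simp [hpdef]
    · simpa using this.symm
  have hUρU : Uᴴ * ρ * U = diagonal (fun x => (r x : ℂ)) := by
    rw [hρU, conjDiag]
    calc _ = (Uᴴ * U) * diagonal (fun x => (r x : ℂ)) * (Uᴴ * U) := by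
          simp only [Matrix.mul_assoc]
      _ = _ := by rw [hU]; simp
  have hr1 : ∑ j, r j = 1 := by
    have := trace_mul_conjDiag ρ U (fun _ => 1)
    rw [conjDiag_one hU, hUρU] at this
    simpa [hρ1] using this.symm
  have hp1 : ∑ j, p j = 1 := by
    have := trace_mul_conjDiag ρ W (fun _ => 1)
    rw [conjDiag_one hW] at this
    simpa [hρ1] using this.symm
  have hD : qRelEnt ρ σ = ∑ j, r j * Real.log (r j) - ∑ j, p j * Real.log (s j) := by
    rw [qRelEnt, Matrix.mul_sub, trace_sub, Complex.sub_re, hlogρ, hlogσ, trace_mul_conjDiag,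
      trace_mul_conjDiag, hUρU]
    simp [hpdef, mul_comm]
  set m₁ := ∑ j, r j * Real.log (r j) with hm₁
  set m₂ := ∑ j, p j * -Real.log (s j) with hm₂
  have hD' : qRelEnt ρ σ = m₁ + m₂ := by simp [hD, hm₂, sub_eq_add_neg]
  refine ⟨4 * ((∑ j, r j * (Real.log (r j) - m₁) ^ 2) / ε ^ 2 +
    (∑ j, p j * (-Real.log (s j) - m₂) ^ 2) / ε ^ 2), fun n hn A hA => ?_⟩
  set U' := tensPow U n
  set W' := tensPow W n
  have hU' : U'ᴴ * U' = 1 := by rw [← tensPow_conjTranspose, ← tensPow_mul, hU, tensPow_one]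
  have hW' : W'ᴴ * W' = 1 := by rw [← tensPow_conjTranspose, ← tensPow_mul, hW, tensPow_one]
  set S : (Fin n → Fin k) → ℝ :=
    fun x => if ∑ i, Real.log (r (x i)) ≤ n * (m₁ + ε) then 1 else 0 with hS
  set T : (Fin n → Fin k) → ℝ :=
    fun x => if ∑ i, -Real.log (s (x i)) ≤ n * (m₂ + ε) then 1 else 0 with hT
  have hSS : (fun x => S x * S x) = S := by ext x; simp [hS]
  have hTT : (fun x => T x * T x) = T := by ext x; simp [hT]
  have hρn : tensPow ρ n = conjDiag U' (fun x => ∏ i, r (x i)) := by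
    rw [hρU, tensPow_conjDiag]
  have hσn : tensPow σ n = conjDiag W' (fun x => ∏ i, s (x i)) := by
    rw [hσW, tensPow_conjDiag]
  have main := trace_test_le (P := conjDiag U' S) (Q := conjDiag W' T) (σ := tensPow σ n)
    (a := Real.exp (n * (m₁ + ε))) (b := Real.exp (-(n * (m₂ + ε))))
    (tensPow_posSemidef hρ n) hA (conjDiag_isHermitian _ _) (by rw [conjDiag_mul hU', hSS])
    (conjDiag_isHermitian _ _) (by rw [conjDiag_mul hW', hTT]) (Real.exp_pos _).le
    (Real.exp_pos _) ?_ ?_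
  · have hexp : Real.exp (n * (m₁ + ε)) / Real.exp (-(n * (m₂ + ε))) =
        Real.exp (n * (qRelEnt ρ σ + 2 * ε)) := by
      rw [← Real.exp_sub, hD']; congr 1; ring
    have hδ₁ : (trace (tensPow ρ n * (1 - conjDiag U' S))).re ≤
        (∑ j, r j * (Real.log (r j) - m₁) ^ 2) / ε ^ 2 * (n : ℝ)⁻¹ := by
      rw [← conjDiag_one hU', conjDiag_sub, trace_mul_conjDiag]
      convert! iid_tail_le (f := fun j => Real.log (r j)) hr0 hr1 hε hn using 3 with x
      rw [← tensPow_conjTranspose, ← tensPow_mul, ← tensPow_mul, hUρU, tensPow_diagonal,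
        diagonal_apply_eq, ← Complex.ofReal_prod, Complex.ofReal_re]
    have hδ₂ : (trace (tensPow ρ n * (1 - conjDiag W' T))).re ≤
        (∑ j, p j * (-Real.log (s j) - m₂) ^ 2) / ε ^ 2 * (n : ℝ)⁻¹ := by
      rw [← conjDiag_one hW', conjDiag_sub, trace_mul_conjDiag]
      convert! iid_tail_le (f := fun j => -Real.log (s j)) hp0 hp1 hε hn using 3 with x
      rw [← tensPow_conjTranspose, ← tensPow_mul, ← tensPow_mul]
      simp only [tensPow, hpc]
      rw [← Complex.ofReal_prod, Complex.ofReal_re]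
    rw [hexp] at main
    nlinarith
  · rw [hρn, conjDiag_mul hU', conjDiag_mul hU', ← conjDiag_one hU', ← conjDiag_const_mul,
      conjDiag_sub]
    refine conjDiag_posSemidef _ fun x => ?_
    have hle : ∏ i, r (x i) ≤ Real.exp (∑ i, Real.log (r (x i))) := by
      rw [Real.exp_sum]
      exact Finset.prod_le_prod (fun i _ => hr0 _) fun i _ => Real.le_exp_log _
    by_cases h : ∑ i, Real.log (r (x i)) ≤ n * (m₁ + ε)
    · have := hle.trans (Real.exp_le_exp.mpr h)
      simpa [hS, h] using this
    · simp only [hS, h]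
      simp [(Real.exp_pos _).le]
  · rw [hσn, ← conjDiag_const_mul, conjDiag_sub]
    refine conjDiag_posSemidef _ fun x => ?_
    have heq : ∏ i, s (x i) = Real.exp (∑ i, Real.log (s (x i))) := by
      rw [Real.exp_sum]
      exact Finset.prod_congr rfl fun i _ => (Real.exp_log (hs0 _)).symm
    by_cases h : ∑ i, -Real.log (s (x i)) ≤ n * (m₂ + ε)
    · simp only [hT, if_pos h, mul_one, heq, sub_nonneg, Real.exp_le_exp]
      rw [Finset.sum_neg_distrib] at h
      linarith
    · simp only [hT, if_neg h, heq]
      simp [(Real.exp_pos _).le]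

theorem IsTest.trace_mul_re_mem {d : Type*} [Fintype d] [DecidableEq d] {M A : Matrix d d ℂ}
    (hM : M.PosSemidef) (hM1 : M.trace = 1) (hA : IsTest A) :
    0 ≤ (trace (M * A)).re ∧ (trace (M * A)).re ≤ 1 := by
  refine ⟨trace_mul_re_nonneg hM hA.1, ?_⟩
  have := trace_mul_re_mono hM hA.2
  simpa [hM1] using this

/-- **Strong converse bound (Theorem 3).** For any sequence of tests whose first error
probability has `limsup < 1`, the second error exponent cannot beat `-D(ρ‖σ)`. -/
theorem stmt_2 (k : ℕ) (ρ σ : Matrix (Fin k) (Fin k) ℂ)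
    (hρ : ρ.PosSemidef) (hρ1 : ρ.trace = 1)
    (hσ : σ.PosDef) (hσ1 : σ.trace = 1)
    (A : ∀ n : ℕ, Matrix (Fin n → Fin k) (Fin n → Fin k) ℂ)
    (hA : ∀ n, IsTest (A n))
    (hα : Filter.limsup (fun n : ℕ => (Matrix.trace (tensPow ρ n * (1 - A n))).re)
      Filter.atTop < 1) :
    -qRelEnt ρ σ ≤
      Filter.limsup
        (fun n : ℕ => (1 / (n : ℝ)) * Real.log (Matrix.trace (tensPow σ n * A n)).re)
        Filter.atTop := by
  have hρn1 : ∀ n, (tensPow ρ n).trace = 1 := fun n => by rw [tensPow_trace, hρ1, one_pow]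
  have hσn1 : ∀ n, (tensPow σ n).trace = 1 := fun n => by rw [tensPow_trace, hσ1, one_pow]
  have hA' : ∀ n, IsTest (1 - A n) := fun n => ⟨(hA n).2, by simpa using (hA n).1⟩
  obtain ⟨c, hc, hc1⟩ := exists_between hα
  have hev := eventually_lt_of_limsup_lt hc (isBoundedUnder_of
    ⟨1, fun n => ((hA' n).trace_mul_re_mem (tensPow_posSemidef hρ n) (hρn1 n)).2⟩)
  have hbdd : IsBoundedUnder (· ≤ ·) atTop
      (fun n : ℕ => (1 / (n : ℝ)) * Real.log (trace (tensPow σ n * A n)).re) := by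
    refine isBoundedUnder_of ⟨0, fun n => ?_⟩
    obtain ⟨h0, h1⟩ := (hA n).trace_mul_re_mem (tensPow_posSemidef hσ.posSemidef n) (hσn1 n)
    exact mul_nonpos_of_nonneg_of_nonpos (by positivity) (Real.log_nonpos h0 h1)
  refine le_of_forall_pos_le_add fun δ hδ => ?_
  obtain ⟨C, hC⟩ := exists_trace_tensPow_test_le hρ hρ1 hσ (show 0 < δ / 4 by positivity)
  have hinv : Tendsto (fun n : ℕ => (n : ℝ)⁻¹) atTop (nhds 0) := tendsto_inv_atTop_nhds_zero_nat
  have hCn : ∀ᶠ n : ℕ in atTop, C * (n : ℝ)⁻¹ < (1 - c) / 2 := by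
    refine (hinv.const_mul C).eventually_lt_const ?_
    rw [mul_zero]; linarith
  have hLn : ∀ᶠ n : ℕ in atTop, -(δ / 2) < Real.log ((1 - c) / 4) * (n : ℝ)⁻¹ := by
    refine (hinv.const_mul _).eventually_const_lt ?_
    rw [mul_zero]; linarith
  rw [← sub_le_iff_le_add]
  refine le_limsup_of_frequently_le (Eventually.frequently ?_) hbdd
  filter_upwards [hev, hCn, hLn, eventually_gt_atTop 0] with n h1 h2 h3 hn
  have hn' : (0 : ℝ) < n := Nat.cast_pos.mpr hn
  have h4 := hC n hn (A n) (hA n)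
  rw [Matrix.mul_sub, trace_sub, Matrix.mul_one, hρn1, Complex.sub_re, Complex.one_re] at h1
  set t := (trace (tensPow σ n * A n)).re
  set E := n * (qRelEnt ρ σ + 2 * (δ / 4)) with hE
  have h5 : (1 - c) / 4 ≤ Real.exp E * t := by linarith
  have ht : 0 < t := by
    by_contra h
    have := mul_nonpos_of_nonneg_of_nonpos (Real.exp_pos E).le (not_lt.mp h)
    linarith
  have h6 := Real.log_le_log (by linarith) h5
  rw [Real.log_mul (Real.exp_pos _).ne' ht.ne', Real.log_exp] at h6
  have h7 : Real.log ((1 - c) / 4) * (n : ℝ)⁻¹ ≤ (E + Real.log t) * (n : ℝ)⁻¹ := by gcongr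
  have h8 : (E + Real.log t) * (n : ℝ)⁻¹ =
      qRelEnt ρ σ + δ / 2 + 1 / (n : ℝ) * Real.log t := by
    rw [hE]; field_simp; ring
  linarith
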